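/- Fix α > 0 and let g belong to the class S_α(ℝ). Write g_even(u) = (g(u)+g(−u))/2 and g_odd(u) = (g(u)−g(−u))/2, and for t > 0 define T_t^α g(u) = (4πt)^{−1/2} { ∫_ℝ e^{−(u−y)²/(4t)} g_even(y) dy + e^{2αu} ∫_u^{∞} e^{−2αz} ∫_0^{∞} [ ((z−y+4αt)/(2t)) e^{−(z−y)²/(4t)} + ((z+y−4αt)/(2t)) e^{−(z+y)²/(4t)} ] g_odd(y) dy dz } for u > 0, and T_t^α g(u) = (4πt)^{−1/2} { ∫_ℝ e^{−(u−y)²/(4t)} g_even(y) dy − e^{−2αu} ∫_{−u}^{∞} e^{−2αz} ∫_0^{∞} [ ((z−y+4αt)/(2t)) e^{−(z−y)²/(4t)} + ((z+y−4αt)/(2t)) e^{−(z+y)²/(4t)} ] g_odd(y) dy dz } for u < 0. Then for every t > 0 and every u ≠ 0 the partial derivatives ∂_t T_t^α g(u) and ∂²_{uu} T_t^α g(u) exist and ∂_t T_t^α g(u) = ∂²_{uu} T_t^α g(u); moreover, for every u ≠ 0, T_t^α g(u) → g(u) as t → 0⁺. -/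

import Mathlib

open MeasureTheory Filter
open scoped BoundedContinuousFunction NNReal

/-- `f` belongs to the class `S_α(ℝ)` of test functions: smooth away from the origin,
continuous from the left at `0`, with fast decay of all derivatives, one-sided limits
of all derivatives at `0`, and satisfying the Robin-type boundary conditions
`f^{(2k+1)}(0⁺) = f^{(2k+1)}(0⁻) = α (f^{(2k)}(0⁺) − f^{(2k)}(0⁻))`. -/
structure IsSAlpha (α : ℝ) (f : ℝ → ℝ) : Prop where
  smooth : ContDiffOn ℝ (⊤ : ℕ∞) f {(0 : ℝ)}ᶜ
  left_cont : Filter.Tendsto f (nhdsWithin 0 (Set.Iio 0)) (nhds (f 0))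
  decay : ∀ k ℓ : ℕ, ∃ M : ℝ, ∀ u : ℝ, u ≠ 0 → (1 + |u| ^ ℓ) * |iteratedDeriv k f u| ≤ M
  robin : ∀ k : ℕ, ∃ Lp Lm Dp Dm : ℝ,
    Filter.Tendsto (iteratedDeriv (2 * k) f) (nhdsWithin 0 (Set.Ioi 0)) (nhds Lp) ∧
    Filter.Tendsto (iteratedDeriv (2 * k) f) (nhdsWithin 0 (Set.Iio 0)) (nhds Lm) ∧
    Filter.Tendsto (iteratedDeriv (2 * k + 1) f) (nhdsWithin 0 (Set.Ioi 0)) (nhds Dp) ∧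
    Filter.Tendsto (iteratedDeriv (2 * k + 1) f) (nhdsWithin 0 (Set.Iio 0)) (nhds Dm) ∧
    Dp = α * (Lp - Lm) ∧ Dm = α * (Lp - Lm)

/-- The explicit semigroup `T_t^α` associated with the heat equation with Robin boundary
condition at `0`, given by the formulas of Proposition 2.3. -/
noncomputable def Talpha (α : ℝ) (g : ℝ → ℝ) (t u : ℝ) : ℝ :=
  (Real.sqrt (4 * Real.pi * t))⁻¹ *
    ((∫ y : ℝ, Real.exp (-((u - y) ^ 2) / (4 * t)) * ((g y + g (-y)) / 2)) +
      if 0 < u then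
        Real.exp (2 * α * u) *
          ∫ z in Set.Ioi u, Real.exp (-(2 * α * z)) *
            ∫ y in Set.Ioi (0 : ℝ),
              (((z - y + 4 * α * t) / (2 * t)) * Real.exp (-((z - y) ^ 2) / (4 * t)) +
                ((z + y - 4 * α * t) / (2 * t)) * Real.exp (-((z + y) ^ 2) / (4 * t))) *
                ((g y - g (-y)) / 2)
      else
        -(Real.exp (-(2 * α * u)) *
          ∫ z in Set.Ioi (-u), Real.exp (-(2 * α * z)) *
            ∫ y in Set.Ioi (0 : ℝ),
              (((z - y + 4 * α * t) / (2 * t)) * Real.exp (-((z - y) ^ 2) / (4 * t)) +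
                ((z + y - 4 * α * t) / (2 * t)) * Real.exp (-((z + y) ^ 2) / (4 * t))) *
                ((g y - g (-y)) / 2)))

lemma hda_congr {f g : ℝ → ℝ} {f' g' x : ℝ} (h : HasDerivAt f f' x) (hfg : ∀ y, g y = f y)
    (h' : g' = f') : HasDerivAt g g' x := by
  rw [funext hfg, h']; exact h

noncomputable def psiK (j : ℕ) (t x : ℝ) : ℝ := x ^ j * Real.exp (-(x ^ 2) / (4 * t))

noncomputable def JK (j : ℕ) (F : ℝ → ℝ) (t u : ℝ) : ℝ := ∫ y : ℝ, psiK j t (u - y) * F y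

noncomputable def DK (t : ℝ) : ℝ := 2 * Real.exp (1 / (4 * t)) / (1 / (4 * t)) ^ 2

lemma DK_nonneg (t : ℝ) : 0 ≤ DK t := by unfold DK; positivity

lemma psiK_bound {j : ℕ} (hj : j ≤ 2) {t : ℝ} (ht : 0 < t) (x : ℝ) :
    |psiK j t x| ≤ DK t * (1 + x ^ 2)⁻¹ := by
  have hc : 0 < 1 / (4 * t) := by positivity
  set c := 1 / (4 * t) with hcdef
  have h1 := Real.pow_div_factorial_le_exp (c * (1 + x ^ 2)) (by positivity) 2
  have h2 : |x| ^ j ≤ 1 + x ^ 2 := by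
    have := sq_abs x
    have := abs_nonneg x
    interval_cases j <;> nlinarith [sq_nonneg (|x| - 1)]
  have h3 : -(x ^ 2) / (4 * t) = -(c * x ^ 2) := by rw [hcdef]; ring
  have h4 : Real.exp (c * (1 + x ^ 2)) = Real.exp c * Real.exp (c * x ^ 2) := by
    rw [← Real.exp_add]; ring_nf
  unfold psiK
  rw [abs_mul, abs_pow, Real.abs_exp, h3, Real.exp_neg, ← div_eq_mul_inv, ← div_eq_mul_inv,
    div_le_div_iff₀ (Real.exp_pos _) (by positivity)]
  calc |x| ^ j * (1 + x ^ 2) ≤ (1 + x ^ 2) * (1 + x ^ 2) := by gcongr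
    _ = 2 / c ^ 2 * ((c * (1 + x ^ 2)) ^ 2 / (2 : ℕ).factorial) := by
        simp [Nat.factorial]; field_simp
    _ ≤ 2 / c ^ 2 * (Real.exp c * Real.exp (c * x ^ 2)) := by rw [← h4]; gcongr
    _ = DK t * Real.exp (c * x ^ 2) := by unfold DK; rw [← hcdef]; ring

lemma psiK_cont (j : ℕ) (t : ℝ) : Continuous (psiK j t) := by unfold psiK; fun_prop

lemma psiK_integrable {j : ℕ} (hj : j ≤ 2) {t : ℝ} (ht : 0 < t) {F : ℝ → ℝ} {B : ℝ}
    (hF : Measurable F) (hB : ∀ y, |F y| ≤ B) (u : ℝ) :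
    Integrable (fun y => psiK j t (u - y) * F y) := by
  have h0 : Integrable (fun y : ℝ => DK t * (1 + (u - y) ^ 2)⁻¹ * B) :=
    ((integrable_inv_one_add_sq.comp_sub_left u).const_mul _).mul_const _
  refine h0.mono' ?_ ?_
  · exact (((psiK_cont j t).comp (continuous_const.sub continuous_id)).measurable.mul
      hF).aestronglyMeasurable
  · refine Eventually.of_forall fun y => ?_
    rw [Real.norm_eq_abs, abs_mul]
    have := DK_nonneg t
    exact mul_le_mul (psiK_bound hj ht _) (hB y) (abs_nonneg _) (by positivity)

lemma JK_bound {j : ℕ} (hj : j ≤ 2) {t : ℝ} (ht : 0 < t) {F : ℝ → ℝ} {B : ℝ}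
    (hB : ∀ y, |F y| ≤ B) (u : ℝ) :
    |JK j F t u| ≤ DK t * Real.pi * B := by
  have h0 : Integrable (fun y : ℝ => DK t * (1 + (u - y) ^ 2)⁻¹ * B) :=
    ((integrable_inv_one_add_sq.comp_sub_left u).const_mul _).mul_const _
  have h := norm_integral_le_of_norm_le (f := fun y => psiK j t (u - y) * F y) h0 ?_
  · refine h.trans (le_of_eq ?_)
    rw [integral_mul_const, integral_const_mul,
      integral_sub_left_eq_self (fun y : ℝ => (1 + y ^ 2)⁻¹) volume u, integral_univ_inv_one_add_sq]
  · refine Eventually.of_forall fun y => ?_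
    rw [Real.norm_eq_abs, abs_mul]
    have := DK_nonneg t
    exact mul_le_mul (psiK_bound hj ht _) (hB y) (abs_nonneg _) (by positivity)

lemma conv_deriv {φ φ' : ℝ → ℝ} {C B : ℝ} (hC : 0 ≤ C) (hd : ∀ x, HasDerivAt φ (φ' x) x)
    (hc' : Continuous φ') (h0 : ∀ x, |φ x| ≤ C * (1 + x ^ 2)⁻¹)
    (h1 : ∀ x, |φ' x| ≤ C * (1 + x ^ 2)⁻¹) {F : ℝ → ℝ}
    (hF : Measurable F) (hB : ∀ y, |F y| ≤ B) (u : ℝ) :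
    HasDerivAt (fun v => ∫ y, φ (v - y) * F y) (∫ y, φ' (u - y) * F y) u := by
  have hc : Continuous φ := continuous_iff_continuousAt.2 fun x => (hd x).continuousAt
  have hm : ∀ v, Measurable (fun y => φ (v - y) * F y) := fun v =>
    (hc.comp (continuous_const.sub continuous_id)).measurable.mul hF
  have hm' : ∀ v, Measurable (fun y => φ' (v - y) * F y) := fun v =>
    (hc'.comp (continuous_const.sub continuous_id)).measurable.mul hF
  have hi : ∀ K : ℝ, Integrable (fun y : ℝ => K * (1 + (u - y) ^ 2)⁻¹ * B) := fun K =>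
    ((integrable_inv_one_add_sq.comp_sub_left u).const_mul _).mul_const _
  refine (hasDerivAt_integral_of_dominated_loc_of_deriv_le (Metric.ball_mem_nhds u one_pos)
    (Eventually.of_forall fun v => (hm v).aestronglyMeasurable) ?_ (hm' u).aestronglyMeasurable
    (bound := fun y => 3 * C * (1 + (u - y) ^ 2)⁻¹ * B)
    (F' := fun v y => φ' (v - y) * F y) ?_ (hi _) ?_).2
  · refine (hi C).mono' (hm u).aestronglyMeasurable (Eventually.of_forall fun y => ?_)
    rw [Real.norm_eq_abs, abs_mul]
    exact mul_le_mul (h0 _) (hB y) (abs_nonneg _) (by positivity)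
  · refine Eventually.of_forall fun y v hv => ?_
    rw [Real.norm_eq_abs, abs_mul]
    refine mul_le_mul ((h1 _).trans ?_) (hB y) (abs_nonneg _) (by positivity)
    rw [Metric.mem_ball, Real.dist_eq] at hv
    have hv2 := abs_lt.1 hv
    rw [← div_eq_mul_inv, ← div_eq_mul_inv, div_le_div_iff₀ (by positivity) (by positivity)]
    have : 1 + (u - y) ^ 2 ≤ 3 * (1 + (v - y) ^ 2) := by
      nlinarith [sq_nonneg ((v - y) + (v - u))]
    nlinarith
  · refine Eventually.of_forall fun y v _ => ?_
    have := ((hd (v - y)).comp_sub_const v y).mul_const (F y)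
    exact this

lemma psiK0_deriv {t : ℝ} (ht : 0 < t) (x : ℝ) :
    HasDerivAt (psiK 0 t) (-(1 / (2 * t)) * psiK 1 t x) x := by
  have h := ((((hasDerivAt_id x).pow 2).neg).div_const (4 * t)).exp
  refine hda_congr h (fun y => ?_) ?_
  · simp [psiK]
  · simp [psiK]; field_simp; ring

lemma psiK1_deriv {t : ℝ} (ht : 0 < t) (x : ℝ) :
    HasDerivAt (psiK 1 t) (psiK 0 t x - 1 / (2 * t) * psiK 2 t x) x := by
  have h := (hasDerivAt_id x).mul (psiK0_deriv ht x)
  refine hda_congr h (fun y => ?_) ?_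
  · simp [psiK]
  · simp [psiK]; ring

lemma JK0_deriv {t : ℝ} (ht : 0 < t) {F : ℝ → ℝ} {B : ℝ}
    (hF : Measurable F) (hB : ∀ y, |F y| ≤ B) (u : ℝ) :
    HasDerivAt (JK 0 F t) (-(1 / (2 * t)) * JK 1 F t u) u := by
  have hD := DK_nonneg t
  have h := conv_deriv (C := DK t + 1 / (2 * t) * DK t) (by positivity) (psiK0_deriv ht)
    ((psiK_cont 1 t).const_smul (-(1 / (2 * t)))) ?_ ?_ hF hB u
  · refine hda_congr h (fun y => rfl) ?_
    unfold JK
    rw [← integral_const_mul]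
    congr 1; ext y; ring
  · intro x
    refine (psiK_bound (by norm_num) ht x).trans ?_
    gcongr
    have : 0 ≤ 1 / (2 * t) * DK t := by positivity
    linarith
  · intro x
    rw [abs_mul, abs_neg, abs_of_pos (by positivity : 0 < 1 / (2 * t))]
    have := psiK_bound (j := 1) (by norm_num) ht x
    calc _ ≤ 1 / (2 * t) * (DK t * (1 + x ^ 2)⁻¹) := by gcongr
      _ = (1 / (2 * t) * DK t) * (1 + x ^ 2)⁻¹ := by ring
      _ ≤ _ := by gcongr; linarith

lemma JK1_deriv {t : ℝ} (ht : 0 < t) {F : ℝ → ℝ} {B : ℝ}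
    (hF : Measurable F) (hB : ∀ y, |F y| ≤ B) (u : ℝ) :
    HasDerivAt (JK 1 F t) (JK 0 F t u - 1 / (2 * t) * JK 2 F t u) u := by
  have hD := DK_nonneg t
  have h := conv_deriv (C := DK t + 1 / (2 * t) * DK t) (by positivity) (psiK1_deriv ht)
    ((psiK_cont 0 t).sub ((psiK_cont 2 t).const_smul (1 / (2 * t)))) ?_ ?_ hF hB u
  · refine hda_congr h (fun y => rfl) ?_
    unfold JK
    rw [← integral_const_mul, ← integral_sub (psiK_integrable (by norm_num) ht hF hB u)
      ((psiK_integrable (by norm_num) ht hF hB u).const_mul _)]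
    congr 1; ext y; ring
  · intro x
    refine (psiK_bound (by norm_num) ht x).trans ?_
    gcongr
    have : 0 ≤ 1 / (2 * t) * DK t := by positivity
    linarith
  · intro x
    refine (abs_sub _ _).trans ?_
    rw [abs_mul, abs_of_pos (by positivity : 0 < 1 / (2 * t))]
    have h0 := psiK_bound (j := 0) (by norm_num) ht x
    have h2 := psiK_bound (j := 2) (by norm_num) ht x
    calc _ ≤ DK t * (1 + x ^ 2)⁻¹ + 1 / (2 * t) * (DK t * (1 + x ^ 2)⁻¹) := by gcongr
      _ = _ := by ring

lemma JK0_deriv_t {t : ℝ} (ht : 0 < t) {F : ℝ → ℝ} {B : ℝ}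
    (hF : Measurable F) (hB : ∀ y, |F y| ≤ B) (u : ℝ) :
    HasDerivAt (fun τ => JK 0 F τ u) (1 / (4 * t ^ 2) * JK 2 F t u) t := by
  have hm : ∀ j τ, Measurable (fun y => psiK j τ (u - y) * F y) := fun j τ =>
    ((psiK_cont j τ).comp (continuous_const.sub continuous_id)).measurable.mul hF
  have hB0 : 0 ≤ B := (abs_nonneg _).trans (hB 0)
  have hi : ∀ K : ℝ, Integrable (fun y : ℝ => K * (1 + (u - y) ^ 2)⁻¹ * B) := fun K =>
    ((integrable_inv_one_add_sq.comp_sub_left u).const_mul _).mul_const _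
  have h := (hasDerivAt_integral_of_dominated_loc_of_deriv_le (Ioo_mem_nhds (half_lt_self ht)
    (by linarith : t < 2 * t)) (F := fun τ y => psiK 0 τ (u - y) * F y)
    (Eventually.of_forall fun v => (hm 0 v).aestronglyMeasurable)
    (psiK_integrable (by norm_num) ht hF hB u) (μ := volume)
    (bound := fun y => (1 / (4 * (t / 2) ^ 2)) * DK (2 * t) * (1 + (u - y) ^ 2)⁻¹ * B)
    (F' := fun τ y => 1 / (4 * τ ^ 2) * (psiK 2 τ (u - y) * F y))
    ((hm 2 t).const_mul _).aestronglyMeasurable ?_ (hi _) ?_).2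
  · rw [integral_const_mul] at h
    exact h
  · refine Eventually.of_forall fun y τ hτ => ?_
    have hτ0 : 0 < τ := lt_trans (by positivity) hτ.1
    have hD := DK_nonneg (2 * t)
    rw [Real.norm_eq_abs, abs_mul, abs_mul, abs_of_pos (by positivity : 0 < 1 / (4 * τ ^ 2))]
    have h1 : |psiK 2 τ (u - y)| ≤ |psiK 2 (2 * t) (u - y)| := by
      unfold psiK
      rw [abs_mul, abs_mul, Real.abs_exp, Real.abs_exp]
      refine mul_le_mul_of_nonneg_left (Real.exp_le_exp.2 ?_) (abs_nonneg _)
      rw [neg_div, neg_div]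
      have := hτ.2
      gcongr
    have h2 := h1.trans (psiK_bound (by norm_num) (by positivity : 0 < 2 * t) (u - y))
    have := hτ.1
    calc _ ≤ 1 / (4 * (t / 2) ^ 2) * ((DK (2 * t) * (1 + (u - y) ^ 2)⁻¹) * B) := by
            gcongr
            exact hB y
      _ = _ := by ring
  · refine Eventually.of_forall fun y τ hτ => ?_
    have hτ0 : 0 < τ := lt_trans (by positivity) hτ.1
    have h4 : HasDerivAt (fun τ : ℝ => -((u - y) ^ 2) / (4 * τ))
        ((u - y) ^ 2 / (4 * τ ^ 2)) τ := by
      have := (hasDerivAt_const τ (-((u - y) ^ 2))).div ((hasDerivAt_id τ).const_mul 4)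
        (by simp; positivity)
      refine hda_congr this (fun y => rfl) ?_
      simp; field_simp
    have h5 := h4.exp.mul_const (F y)
    refine hda_congr h5 (fun y => ?_) ?_
    · simp [psiK]
    · simp only [psiK]; ring

/-- heat semigroup -/
noncomputable def WK (F : ℝ → ℝ) (t u : ℝ) : ℝ := (Real.sqrt (4 * Real.pi * t))⁻¹ * JK 0 F t u

lemma WK_deriv {t : ℝ} (ht : 0 < t) {F : ℝ → ℝ} {B : ℝ}
    (hF : Measurable F) (hB : ∀ y, |F y| ≤ B) (u : ℝ) :
    HasDerivAt (WK F t)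
      ((Real.sqrt (4 * Real.pi * t))⁻¹ * (-(1 / (2 * t)) * JK 1 F t u)) u :=
  (JK0_deriv ht hF hB u).const_mul _

noncomputable def W2K (F : ℝ → ℝ) (t u : ℝ) : ℝ :=
  (Real.sqrt (4 * Real.pi * t))⁻¹ * (-(1 / (2 * t)) * (JK 0 F t u - 1 / (2 * t) * JK 2 F t u))

lemma WK_deriv2 {t : ℝ} (ht : 0 < t) {F : ℝ → ℝ} {B : ℝ}
    (hF : Measurable F) (hB : ∀ y, |F y| ≤ B) (u : ℝ) :
    HasDerivAt (deriv (WK F t)) (W2K F t u) u := by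
  have : deriv (WK F t) =
      fun v => (Real.sqrt (4 * Real.pi * t))⁻¹ * (-(1 / (2 * t)) * JK 1 F t v) :=
    funext fun v => (WK_deriv ht hF hB v).deriv
  rw [this]
  exact ((JK1_deriv ht hF hB u).const_mul _).const_mul _

lemma WK_deriv_t {t : ℝ} (ht : 0 < t) {F : ℝ → ℝ} {B : ℝ}
    (hF : Measurable F) (hB : ∀ y, |F y| ≤ B) (u : ℝ) :
    HasDerivAt (fun τ => WK F τ u) (W2K F t u) t := by
  have hp := Real.pi_pos
  have h1 : HasDerivAt (fun τ : ℝ => (Real.sqrt (4 * Real.pi * τ))⁻¹)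
      (-(1 / (2 * t)) * (Real.sqrt (4 * Real.pi * t))⁻¹) t := by
    have h2 := (((hasDerivAt_id t).const_mul (4 * Real.pi)).sqrt (by simp; positivity)).inv
      (by simp; positivity)
    refine hda_congr h2 (fun y => rfl) ?_
    have h3 : Real.sqrt (4 * Real.pi * t) ≠ 0 := by positivity
    simp only [id]
    have h4 := Real.sq_sqrt (by positivity : 0 ≤ 4 * Real.pi * t)
    rw [h4]
    field_simp
  have h := h1.mul (JK0_deriv_t ht hF hB u)
  refine hda_congr h (fun y => rfl) ?_
  unfold W2K
  field_simp
  ring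

lemma WK_tendsto {F : ℝ → ℝ} {B : ℝ}
    (hF : Measurable F) (hB : ∀ y, |F y| ≤ B) {u : ℝ} (hu : ContinuousAt F u) :
    Tendsto (fun t => WK F t u) (nhdsWithin 0 (Set.Ioi 0)) (nhds (F u)) := by
  have hp := Real.pi_pos
  have hg : Integrable (fun s : ℝ => Real.exp (-s ^ 2)) := by
    simpa using integrable_exp_neg_mul_sq one_pos
  have key : ∀ t ∈ Set.Ioi (0 : ℝ), (Real.sqrt Real.pi)⁻¹ *
      ∫ s, Real.exp (-s ^ 2) * F (u - 2 * Real.sqrt t * s) = WK F t u := by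
    intro t ht
    have ht : 0 < t := ht
    have hs : 0 < 2 * Real.sqrt t := by positivity
    have e1 := Measure.integral_comp_mul_left
      (fun x => psiK 0 t x * F (u - x)) (2 * Real.sqrt t)
    have e2 : JK 0 F t u = ∫ x, psiK 0 t x * F (u - x) := by
      rw [← integral_sub_left_eq_self _ volume u]
      simp [JK]
    have e3 : ∀ s, psiK 0 t (2 * Real.sqrt t * s) = Real.exp (-s ^ 2) := by
      intro s
      unfold psiK
      rw [pow_zero, one_mul, mul_pow, mul_pow, Real.sq_sqrt ht.le]
      congr 1; field_simp; ring
    simp only [e3] at e1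
    rw [e1, ← e2, abs_of_pos (by positivity), WK, smul_eq_mul, ← mul_assoc]
    congr 1
    rw [← mul_inv]
    congr 1
    rw [show 4 * Real.pi * t = Real.pi * t * 2 ^ 2 by ring, Real.sqrt_mul (by positivity),
      Real.sqrt_mul (by positivity), Real.sqrt_sq (by norm_num)]
    ring
  have hlim : Tendsto (fun t : ℝ => ∫ s, Real.exp (-s ^ 2) * F (u - 2 * Real.sqrt t * s))
      (nhdsWithin 0 (Set.Ioi 0)) (nhds (∫ s, Real.exp (-s ^ 2) * F u)) := by
    refine tendsto_integral_filter_of_dominated_convergence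
      (fun s => Real.exp (-s ^ 2) * B) ?_ ?_ (hg.mul_const _) ?_
    · refine Eventually.of_forall fun t => Measurable.aestronglyMeasurable ?_
      exact (by fun_prop : Measurable fun s : ℝ => Real.exp (-s ^ 2)).mul
        (hF.comp (by fun_prop))
    · refine Eventually.of_forall fun t => Eventually.of_forall fun s => ?_
      rw [Real.norm_eq_abs, abs_mul, Real.abs_exp]
      gcongr
      exact hB _
    · refine Eventually.of_forall fun s => Tendsto.const_mul _ ?_
      have hc : Tendsto (fun t : ℝ => u - 2 * Real.sqrt t * s) (nhdsWithin 0 (Set.Ioi 0))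
          (nhds u) := by
        have : Continuous (fun t : ℝ => u - 2 * Real.sqrt t * s) := by fun_prop
        have h := this.tendsto 0
        simp only [Real.sqrt_zero, mul_zero, zero_mul, sub_zero] at h
        exact h.mono_left nhdsWithin_le_nhds
      exact hu.tendsto.comp hc
  have h2 := hlim.const_mul (Real.sqrt Real.pi)⁻¹
  rw [integral_mul_const] at h2
  have h3 : ∫ s : ℝ, Real.exp (-s ^ 2) = Real.sqrt Real.pi := by
    simpa using integral_gaussian 1
  rw [h3, ← mul_assoc, inv_mul_cancel₀ (by positivity), one_mul] at h2
  refine h2.congr' ?_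
  filter_upwards [self_mem_nhdsWithin] with t ht using key t ht

noncomputable def HK (α : ℝ) (h : ℝ → ℝ) (w : ℝ) : ℝ :=
  Real.exp (-(2 * α * w)) * ∫ y in (0 : ℝ)..w, Real.exp (2 * α * y) * h y

lemma HK_ii {α : ℝ} {h : ℝ → ℝ} {B : ℝ} (hh : Measurable h) (hB : ∀ y, |h y| ≤ B) (a b : ℝ) :
    IntervalIntegrable (fun y => Real.exp (2 * α * y) * h y) volume a b := by
  have h1 : IntervalIntegrable (fun y => Real.exp (2 * α * y) * B) volume a b :=
    (by fun_prop : Continuous fun y => Real.exp (2 * α * y) * B).intervalIntegrable a b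
  refine h1.mono_fun' ?_ (Eventually.of_forall fun y => ?_)
  · exact ((by fun_prop : Measurable fun y => Real.exp (2 * α * y)).mul hh).aestronglyMeasurable
  · simp only [Real.norm_eq_abs, abs_mul, Real.abs_exp]
    gcongr
    exact hB y

lemma HK_cont {α : ℝ} {h : ℝ → ℝ} {B : ℝ} (hh : Measurable h) (hB : ∀ y, |h y| ≤ B) :
    Continuous (HK α h) :=
  (by fun_prop : Continuous fun w => Real.exp (-(2 * α * w))).mul
    (intervalIntegral.continuous_primitive (HK_ii hh hB) 0)

lemma HK_deriv {α : ℝ} {h : ℝ → ℝ} {B : ℝ} (hh : Measurable h) (hB : ∀ y, |h y| ≤ B) {w : ℝ}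
    (hw : ContinuousAt h w) : HasDerivAt (HK α h) (h w - 2 * α * HK α h w) w := by
  have h1 := intervalIntegral.integral_hasDerivAt_right (HK_ii (α := α) hh hB 0 w)
    (((by fun_prop : Measurable fun y => Real.exp (2 * α * y)).mul
      hh).stronglyMeasurable.stronglyMeasurableAtFilter)
    ((by fun_prop : ContinuousAt (fun y => Real.exp (2 * α * y)) w).mul hw)
  have h2 := ((((hasDerivAt_id w).const_mul (2 * α)).neg).exp).mul h1
  refine hda_congr h2 (fun y => by simp [HK]) ?_
  simp only [HK, id, Pi.neg_apply]
  have : Real.exp (-(2 * α * w)) * Real.exp (2 * α * w) = 1 := by rw [← Real.exp_add]; simp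
  linear_combination (- h w) * this

lemma HK_bound {α : ℝ} (hα : 0 < α) {h : ℝ → ℝ} {B : ℝ} (hB : ∀ y, |h y| ≤ B)
    {w : ℝ} (hw : 0 ≤ w) : |HK α h w| ≤ B / (2 * α) := by
  have hB0 : 0 ≤ B := (abs_nonneg _).trans (hB 0)
  have h1 := intervalIntegral.norm_integral_le_of_norm_le (μ := volume) hw
    (f := fun y => Real.exp (2 * α * y) * h y) (g := fun y => Real.exp (2 * α * y) * B)
    (Eventually.of_forall fun y _ => by
      simp only [Real.norm_eq_abs, abs_mul, Real.abs_exp]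
      gcongr
      exact hB y)
    ((by fun_prop : Continuous fun y => Real.exp (2 * α * y) * B).intervalIntegrable 0 w)
  have h2 : ∫ y in (0 : ℝ)..w, Real.exp (2 * α * y) * B
      = Real.exp (2 * α * w) * (B / (2 * α)) - B / (2 * α) := by
    rw [intervalIntegral.integral_eq_sub_of_hasDerivAt
      (f := fun y => Real.exp (2 * α * y) * (B / (2 * α)))]
    · simp
    · intro x _
      have := (((hasDerivAt_id x).const_mul (2 * α)).exp).mul_const (B / (2 * α))
      refine hda_congr this (fun y => by simp) ?_
      simp; field_simp
    · exact (by fun_prop : Continuous fun y => Real.exp (2 * α * y) * B).intervalIntegrable 0 w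
  rw [h2, Real.norm_eq_abs] at h1
  unfold HK
  rw [abs_mul, Real.abs_exp]
  have e : Real.exp (-(2 * α * w)) * Real.exp (2 * α * w) = 1 := by rw [← Real.exp_add]; simp
  have e0 : 0 ≤ Real.exp (-(2 * α * w)) * (B / (2 * α)) := by positivity
  calc _ ≤ Real.exp (-(2 * α * w)) * (Real.exp (2 * α * w) * (B / (2 * α)) - B / (2 * α)) := by
          gcongr
    _ ≤ B / (2 * α) := by rw [mul_sub, ← mul_assoc, e]; linarith

noncomputable def qK (α : ℝ) (h : ℝ → ℝ) (y : ℝ) : ℝ :=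
  if 0 < y then h y else h (-y) - 4 * α * HK α h (-y)

lemma qK_meas {α : ℝ} {h : ℝ → ℝ} {B : ℝ} (hh : Measurable h) (hB : ∀ y, |h y| ≤ B) :
    Measurable (qK α h) := by
  unfold qK
  refine Measurable.ite measurableSet_Ioi hh ?_
  exact (hh.comp measurable_neg).sub (((HK_cont hh hB).measurable.comp measurable_neg).const_mul _)

lemma qK_bound {α : ℝ} (hα : 0 < α) {h : ℝ → ℝ} {B : ℝ} (hB : ∀ y, |h y| ≤ B) (y : ℝ) :
    |qK α h y| ≤ 3 * B := by
  have hB0 : 0 ≤ B := (abs_nonneg _).trans (hB 0)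
  unfold qK
  split_ifs with hy
  · linarith [hB y]
  · have h1 := HK_bound hα hB (w := -y) (by linarith)
    refine (abs_sub _ _).trans ?_
    rw [abs_mul, abs_of_pos (by positivity : 0 < 4 * α)]
    have : 4 * α * |HK α h (-y)| ≤ 4 * α * (B / (2 * α)) := by gcongr
    have e : 4 * α * (B / (2 * α)) = 2 * B := by field_simp; ring
    linarith [hB (-y)]

lemma psiK_integrable' {j : ℕ} (hj : j ≤ 2) {t : ℝ} (ht : 0 < t) {F : ℝ → ℝ} {B : ℝ}
    (hF : Measurable F) (hB : ∀ y, |F y| ≤ B) (u : ℝ) :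
    Integrable (fun y => psiK j t (u + y) * F y) := by
  have := (psiK_integrable hj ht (hF.comp measurable_neg) (fun y => hB (-y)) u).comp_neg
  simpa using this

lemma total_deriv {α : ℝ} (hα : 0 < α) {h : ℝ → ℝ} {B : ℝ} (hh : Measurable h)
    (hB : ∀ y, |h y| ≤ B) (hc : ∀ y, 0 < y → ContinuousAt h y) {t : ℝ} (ht : 0 < t) (z : ℝ) :
    IntegrableOn (fun y => psiK 0 t (z + y) * (h y - 2 * α * HK α h y)
      - 1 / (2 * t) * psiK 1 t (z + y) * HK α h y) (Set.Ioi 0) ∧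
    ∫ y in Set.Ioi (0 : ℝ), (psiK 0 t (z + y) * (h y - 2 * α * HK α h y)
      - 1 / (2 * t) * psiK 1 t (z + y) * HK α h y) = 0 := by
  set HM : ℝ → ℝ := fun y => HK α h (max y 0) with hHM
  have hMm : Measurable HM := ((HK_cont hh hB).comp (by fun_prop)).measurable
  have hMb : ∀ y, |HM y| ≤ B / (2 * α) := fun y => HK_bound hα hB (le_max_right _ _)
  have hE : ∀ y ∈ Set.Ioi (0 : ℝ), HM y = HK α h y := by
    intro y hy
    simp only [hHM]
    rw [max_eq_left (le_of_lt hy)]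
  have i0 : IntegrableOn (fun y => psiK 0 t (z + y) * HK α h y) (Set.Ioi 0) := by
    refine (psiK_integrable' (j := 0) (by norm_num) ht hMm hMb z).integrableOn.congr_fun
      (fun y hy => ?_) measurableSet_Ioi
    simp only [hE y hy]
  have i1 : IntegrableOn (fun y => psiK 0 t (z + y) * (h y - 2 * α * HK α h y)
      - 1 / (2 * t) * psiK 1 t (z + y) * HK α h y) (Set.Ioi 0) := by
    have a0 := psiK_integrable' (j := 0) (by norm_num) ht hMm hMb z
    have a1 := psiK_integrable' (j := 1) (by norm_num) ht hMm hMb z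
    have a2 := psiK_integrable' (j := 0) (by norm_num) ht hh hB z
    refine ((a2.sub (a0.const_mul (2 * α))).sub (a1.const_mul (1 / (2 * t)))).integrableOn.congr_fun
      (fun y hy => ?_) measurableSet_Ioi
    simp only [Pi.sub_apply, hE y hy]
    ring
  refine ⟨i1, ?_⟩
  have hd : ∀ y ∈ Set.Ioi (0 : ℝ), HasDerivAt (fun y => psiK 0 t (z + y) * HK α h y)
      (psiK 0 t (z + y) * (h y - 2 * α * HK α h y)
      - 1 / (2 * t) * psiK 1 t (z + y) * HK α h y) y := by
    intro y hy
    have := ((psiK0_deriv ht (z + y)).comp_const_add z y).mul (HK_deriv (α := α) hh hB (hc y hy))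
    refine hda_congr this (fun y => rfl) ?_
    ring
  have ht0 := tendsto_zero_of_hasDerivAt_of_integrableOn_Ioi hd i1 i0
  have hcont : Continuous (fun y => psiK 0 t (z + y) * HK α h y) :=
    ((psiK_cont 0 t).comp (by fun_prop)).mul (HK_cont hh hB)
  rw [integral_Ioi_of_hasDerivAt_of_tendsto hcont.continuousWithinAt hd i1 ht0]
  simp [HK]

noncomputable def PhiK (α : ℝ) (h : ℝ → ℝ) (t z : ℝ) : ℝ :=
  ∫ y in Set.Ioi (0 : ℝ),
    (((z - y + 4 * α * t) / (2 * t)) * Real.exp (-((z - y) ^ 2) / (4 * t)) +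
      ((z + y - 4 * α * t) / (2 * t)) * Real.exp (-((z + y) ^ 2) / (4 * t))) * h y

lemma PhiK_eq {α : ℝ} (hα : 0 < α) {h : ℝ → ℝ} {B : ℝ} (hh : Measurable h)
    (hB : ∀ y, |h y| ≤ B) (hc : ∀ y, 0 < y → ContinuousAt h y) {t : ℝ} (ht : 0 < t) (z : ℝ) :
    PhiK α h t z = 1 / (2 * t) * JK 1 (qK α h) t z + 2 * α * JK 0 (qK α h) t z := by
  have hqm := qK_meas (α := α) hh hB
  have hqb := qK_bound hα hB
  have i1 := psiK_integrable (j := 1) (by norm_num) ht hqm hqb z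
  have i0 := psiK_integrable (j := 0) (by norm_num) ht hqm hqb z
  obtain ⟨iT, eT⟩ := total_deriv hα hh hB hc ht z
  have hi : Integrable (fun y => 1 / (2 * t) * (psiK 1 t (z - y) * qK α h y) +
        2 * α * (psiK 0 t (z - y) * qK α h y)) :=
    (i1.const_mul (1 / (2 * t))).add (i0.const_mul (2 * α))
  have e1 : 1 / (2 * t) * JK 1 (qK α h) t z + 2 * α * JK 0 (qK α h) t z
      = ∫ y, (1 / (2 * t) * (psiK 1 t (z - y) * qK α h y) +
        2 * α * (psiK 0 t (z - y) * qK α h y)) := by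
    unfold JK
    rw [← integral_const_mul, ← integral_const_mul,
      integral_add (i1.const_mul _) (i0.const_mul _)]
  rw [e1, ← integral_add_compl (measurableSet_Ioi (a := (0 : ℝ))) hi, Set.compl_Ioi]
  have e2 := integral_comp_neg_Ioi (0 : ℝ) (fun y => (1 / (2 * t) * (psiK 1 t (z - y) * qK α h y) +
        2 * α * (psiK 0 t (z - y) * qK α h y)))
  rw [neg_zero] at e2
  have hi' : IntegrableOn (fun y => 1 / (2 * t) * (psiK 1 t (z - -y) * qK α h (-y)) +
        2 * α * (psiK 0 t (z - -y) * qK α h (-y))) (Set.Ioi 0) := hi.comp_neg.integrableOn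
  rw [← e2, ← integral_add hi.integrableOn hi']
  have e3 := integral_sub (hi.integrableOn.add hi') (iT.const_mul (4 * α))
  rw [integral_const_mul, eT, mul_zero, sub_zero] at e3
  refine Eq.trans ?_ e3
  rw [PhiK]
  refine setIntegral_congr_fun measurableSet_Ioi fun y hy => ?_
  have hy : 0 < y := hy
  have hq1 : qK α h y = h y := by simp [qK, hy]
  have hq2 : qK α h (-y) = h y - 4 * α * HK α h y := by
    simp [qK, hy.le]
  simp only [Pi.add_apply, hq1, hq2, psiK, sub_neg_eq_add]
  field_simp
  ring

lemma outer_eq {α : ℝ} (hα : 0 < α) {h : ℝ → ℝ} {B : ℝ} (hh : Measurable h)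
    (hB : ∀ y, |h y| ≤ B) (hc : ∀ y, 0 < y → ContinuousAt h y) {t : ℝ} (ht : 0 < t) (u : ℝ) :
    Real.exp (2 * α * u) * ∫ z in Set.Ioi u, Real.exp (-(2 * α * z)) * PhiK α h t z
      = JK 0 (qK α h) t u := by
  have hqm := qK_meas (α := α) hh hB
  have hqb := qK_bound hα hB
  have hd : ∀ z, HasDerivAt (fun z => -(Real.exp (-(2 * α * z)) * JK 0 (qK α h) t z))
      (Real.exp (-(2 * α * z)) * PhiK α h t z) z := by
    intro z
    have h1 := (((((hasDerivAt_id z).const_mul (2 * α)).neg).exp).mul (JK0_deriv ht hqm hqb z)).neg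
    refine hda_congr h1 (fun y => by simp) ?_
    rw [PhiK_eq hα hh hB hc ht]
    simp
    ring
  have hPc : Continuous (PhiK α h t) := by
    rw [funext (PhiK_eq hα hh hB hc ht)]
    exact (continuous_const.mul (continuous_iff_continuousAt.2 fun x =>
        (JK1_deriv ht hqm hqb x).continuousAt)).add
      (continuous_const.mul (continuous_iff_continuousAt.2 fun x =>
        (JK0_deriv ht hqm hqb x).continuousAt))
  have hPb : ∀ z, ‖PhiK α h t z‖ ≤ 1 / (2 * t) * (DK t * Real.pi * (3 * B))
      + 2 * α * (DK t * Real.pi * (3 * B)) := by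
    intro z
    rw [PhiK_eq hα hh hB hc ht, Real.norm_eq_abs]
    refine (abs_add_le _ _).trans ?_
    rw [abs_mul, abs_mul, abs_of_pos (by positivity : 0 < 1 / (2 * t)),
      abs_of_pos (by positivity : 0 < 2 * α)]
    gcongr
    · exact JK_bound (by norm_num) ht hqb z
    · exact JK_bound (by norm_num) ht hqb z
  have hE : IntegrableOn (fun z => Real.exp (-(2 * α * z))) (Set.Ioi u) := by
    have := exp_neg_integrableOn_Ioi u (b := 2 * α) (by positivity)
    simpa only [neg_mul] using this
  have hI : IntegrableOn (fun z => Real.exp (-(2 * α * z)) * PhiK α h t z) (Set.Ioi u) := by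
    have := Integrable.bdd_mul hE hPc.aestronglyMeasurable (Eventually.of_forall hPb)
    exact this.congr (Eventually.of_forall fun z => mul_comm _ _)
  have hT : Tendsto (fun z => -(Real.exp (-(2 * α * z)) * JK 0 (qK α h) t z)) atTop (nhds 0) := by
    have h1 : Tendsto (fun z : ℝ => Real.exp (-(2 * α * z)) * (DK t * Real.pi * (3 * B)))
        atTop (nhds 0) := by
      rw [← zero_mul (DK t * Real.pi * (3 * B))]
      refine Tendsto.mul_const _ (Real.tendsto_exp_neg_atTop_nhds_zero.comp ?_)
      exact tendsto_id.const_mul_atTop (by positivity)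
    refine squeeze_zero_norm (fun z => ?_) h1
    rw [norm_neg, norm_mul, Real.norm_eq_abs, Real.abs_exp]
    gcongr
    exact JK_bound (by norm_num) ht hqb z
  rw [integral_Ioi_of_hasDerivAt_of_tendsto (hd u).continuousAt.continuousWithinAt
    (fun z _ => hd z) hI hT, zero_sub, neg_neg, ← mul_assoc, ← Real.exp_add]
  simp

lemma IsSAlpha.contAt {α : ℝ} {g : ℝ → ℝ} (hg : IsSAlpha α g) {u : ℝ} (hu : u ≠ 0) :
    ContinuousAt g u :=
  hg.smooth.continuousOn.continuousAt (isOpen_compl_singleton.mem_nhds hu)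

lemma IsSAlpha.meas {α : ℝ} {g : ℝ → ℝ} (hg : IsSAlpha α g) : Measurable g :=
  measurable_of_continuousOn_compl_singleton 0 hg.smooth.continuousOn

lemma IsSAlpha.bdd {α : ℝ} {g : ℝ → ℝ} (hg : IsSAlpha α g) : ∃ B, ∀ u, |g u| ≤ B := by
  obtain ⟨M, hM⟩ := hg.decay 0 0
  refine ⟨max M |g 0|, fun u => ?_⟩
  by_cases hu : u = 0
  · subst hu; exact le_max_right _ _
  · have := hM u hu
    simp only [pow_zero, iteratedDeriv_zero] at this
    exact le_max_of_le_left (by linarith [abs_nonneg (g u)])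

noncomputable def evK (g : ℝ → ℝ) (y : ℝ) : ℝ := (g y + g (-y)) / 2
noncomputable def odK (g : ℝ → ℝ) (y : ℝ) : ℝ := (g y - g (-y)) / 2

lemma JK0_eq (F : ℝ → ℝ) (t u : ℝ) :
    JK 0 F t u = ∫ y, Real.exp (-((u - y) ^ 2) / (4 * t)) * F y := by
  simp [JK, psiK]

lemma Talpha_pos {α : ℝ} (hα : 0 < α) {g : ℝ → ℝ} {B : ℝ} (hh : Measurable (odK g))
    (hB : ∀ y, |odK g y| ≤ B) (hc : ∀ y, 0 < y → ContinuousAt (odK g) y) {t : ℝ} (ht : 0 < t)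
    {u : ℝ} (hu : 0 < u) :
    Talpha α g t u = WK (evK g) t u + WK (qK α (odK g)) t u := by
  have h := outer_eq hα hh hB hc ht u
  unfold Talpha
  rw [if_pos hu, WK, WK, ← mul_add, ← h, JK0_eq]
  rfl

lemma Talpha_neg {α : ℝ} (hα : 0 < α) {g : ℝ → ℝ} {B : ℝ} (hh : Measurable (odK g))
    (hB : ∀ y, |odK g y| ≤ B) (hc : ∀ y, 0 < y → ContinuousAt (odK g) y) {t : ℝ} (ht : 0 < t)
    {u : ℝ} (hu : u < 0) :
    Talpha α g t u = WK (evK g) t u - WK (qK α (odK g)) t (-u) := by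
  have h := outer_eq hα hh hB hc ht (-u)
  unfold Talpha
  rw [if_neg hu.not_gt, WK, WK, ← mul_sub, ← h, JK0_eq, sub_eq_add_neg, mul_neg]
  rfl

lemma deriv_package {f w : ℝ → ℝ} {u w2 : ℝ} (hfw : ∀ᶠ v in nhds u, f v = w v)
    (h1 : Differentiable ℝ w) (h2 : HasDerivAt (deriv w) w2 u) :
    HasDerivAt f (deriv f u) u ∧ HasDerivAt (deriv f) w2 u := by
  have hfw' : f =ᶠ[nhds u] w := hfw
  exact ⟨(hfw'.symm.differentiableAt_iff.1 (h1 u)).hasDerivAt,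
    h2.congr_of_eventuallyEq hfw'.deriv⟩

/-- **`T_t^α g` solves the heat equation off the origin** (part of Proposition 2.3): for
`g ∈ S_α(ℝ)`, `t > 0` and `u ≠ 0`, the time derivative `∂_t T_t^α g(u)` and the second
space derivative `∂²_{uu} T_t^α g(u)` exist and are equal; moreover `T_t^α g(u) → g(u)`
as `t → 0⁺`. -/
theorem Talpha_solves_heat_equation
    (α : ℝ) (hα : 0 < α) (g : ℝ → ℝ) (hg : IsSAlpha α g) :
    (∀ t : ℝ, 0 < t → ∀ u : ℝ, u ≠ 0 → ∃ d2 : ℝ,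
      HasDerivAt (fun v => Talpha α g t v) (deriv (fun v => Talpha α g t v) u) u ∧
      HasDerivAt (deriv (fun v => Talpha α g t v)) d2 u ∧
      HasDerivAt (fun τ => Talpha α g τ u) d2 t) ∧
    ∀ u : ℝ, u ≠ 0 →
      Filter.Tendsto (fun t => Talpha α g t u) (nhdsWithin 0 (Set.Ioi 0)) (nhds (g u)) := by
  obtain ⟨B, hB⟩ := hg.bdd
  have hgm := hg.meas
  have hgn : Measurable fun y => g (-y) := hgm.comp measurable_neg
  have hem : Measurable (evK g) := (hgm.add hgn).div_const 2
  have hom : Measurable (odK g) := (hgm.sub hgn).div_const 2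
  have heb : ∀ y, |evK g y| ≤ B := by
    intro y
    have h1 := abs_le.1 (hB y)
    have h2 := abs_le.1 (hB (-y))
    unfold evK
    exact abs_le.2 ⟨by linarith, by linarith⟩
  have hob : ∀ y, |odK g y| ≤ B := by
    intro y
    have h1 := abs_le.1 (hB y)
    have h2 := abs_le.1 (hB (-y))
    unfold odK
    exact abs_le.2 ⟨by linarith, by linarith⟩
  have hnc : ∀ y, y ≠ 0 → ContinuousAt (fun y => g (-y)) y := fun y hy =>
    ContinuousAt.comp (g := g) (hg.contAt (neg_ne_zero.2 hy)) continuous_neg.continuousAt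
  have hec : ∀ y, y ≠ 0 → ContinuousAt (evK g) y := fun y hy =>
    ((hg.contAt hy).add (hnc y hy)).div_const 2
  have hoc : ∀ y, y ≠ 0 → ContinuousAt (odK g) y := fun y hy =>
    ((hg.contAt hy).sub (hnc y hy)).div_const 2
  have hoc' : ∀ y, 0 < y → ContinuousAt (odK g) y := fun y hy => hoc y hy.ne'
  have hqm := qK_meas (α := α) hom hob
  have hqb := qK_bound hα hob
  have hqe : ∀ y, 0 < y → qK α (odK g) y = odK g y := fun y hy => by simp [qK, hy]
  have hqc : ∀ y, 0 < y → ContinuousAt (qK α (odK g)) y := fun y hy =>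
    (hoc' y hy).congr (by
      filter_upwards [Ioi_mem_nhds hy] with v hv using (hqe v hv).symm)
  have hed : ∀ t, 0 < t → Differentiable ℝ (WK (evK g) t) := fun t ht v =>
    (WK_deriv ht hem heb v).differentiableAt
  have hqd : ∀ t, 0 < t → Differentiable ℝ (WK (qK α (odK g)) t) := fun t ht v =>
    (WK_deriv ht hqm hqb v).differentiableAt
  constructor
  · intro t ht u hu
    rcases lt_or_gt_of_ne hu with hu | hu
    · refine ⟨W2K (evK g) t u - W2K (qK α (odK g)) t (-u), ?_⟩
      have hP := deriv_package (f := fun v => Talpha α g t v)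
        (w := fun v => WK (evK g) t v - WK (qK α (odK g)) t (-v)) (u := u)
        (w2 := W2K (evK g) t u - W2K (qK α (odK g)) t (-u))
        (by filter_upwards [Iio_mem_nhds hu] with v hv
            exact Talpha_neg hα hom hob hoc' ht hv)
        ((hed t ht).sub ((hqd t ht).comp differentiable_neg)) (by
          have e : deriv (fun v => WK (evK g) t v - WK (qK α (odK g)) t (-v)) =
              fun v => deriv (WK (evK g) t) v + deriv (WK (qK α (odK g)) t) (-v) := by
            funext v
            have h1 := (hed t ht v).hasDerivAt.sub
              ((hqd t ht (-v)).hasDerivAt.comp v (hasDerivAt_neg v))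
            have h2 := h1.deriv
            rw [mul_neg_one, sub_neg_eq_add] at h2
            exact h2
          rw [e]
          have h1 := (WK_deriv2 ht hem heb u).add
              ((WK_deriv2 ht hqm hqb (-u)).comp u (hasDerivAt_neg u))
          exact hda_congr h1 (fun y => rfl) (by ring))
      refine ⟨hP.1, hP.2, ?_⟩
      refine ((WK_deriv_t ht hem heb u).sub (WK_deriv_t ht hqm hqb (-u))).congr_of_eventuallyEq ?_
      filter_upwards [Ioi_mem_nhds ht] with τ hτ
      exact Talpha_neg hα hom hob hoc' hτ hu
    · refine ⟨W2K (evK g) t u + W2K (qK α (odK g)) t u, ?_⟩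
      have hP := deriv_package (f := fun v => Talpha α g t v)
        (w := fun v => WK (evK g) t v + WK (qK α (odK g)) t v) (u := u)
        (w2 := W2K (evK g) t u + W2K (qK α (odK g)) t u)
        (by filter_upwards [Ioi_mem_nhds hu] with v hv
            exact Talpha_pos hα hom hob hoc' ht hv)
        ((hed t ht).add (hqd t ht)) (by
          have e : deriv (fun v => WK (evK g) t v + WK (qK α (odK g)) t v) =
              fun v => deriv (WK (evK g) t) v + deriv (WK (qK α (odK g)) t) v := by
            funext v
            exact ((hed t ht v).hasDerivAt.add (hqd t ht v).hasDerivAt).deriv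
          rw [e]
          exact (WK_deriv2 ht hem heb u).add (WK_deriv2 ht hqm hqb u))
      refine ⟨hP.1, hP.2, ?_⟩
      refine ((WK_deriv_t ht hem heb u).add (WK_deriv_t ht hqm hqb u)).congr_of_eventuallyEq ?_
      filter_upwards [Ioi_mem_nhds ht] with τ hτ
      exact Talpha_pos hα hom hob hoc' hτ hu
  · intro u hu
    have h1 := WK_tendsto hem heb (hec u hu)
    rcases lt_or_gt_of_ne hu with hu | hu
    · have h2 := WK_tendsto hqm hqb (hqc (-u) (by linarith))
      have h3 := h1.sub h2
      have e : evK g u - qK α (odK g) (-u) = g u := by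
        rw [hqe _ (by linarith)]
        simp only [evK, odK, neg_neg]
        ring
      rw [e] at h3
      refine h3.congr' ?_
      filter_upwards [self_mem_nhdsWithin] with t ht
      exact (Talpha_neg hα hom hob hoc' ht hu).symm
    · have h2 := WK_tendsto hqm hqb (hqc u hu)
      have h3 := h1.add h2
      have e : evK g u + qK α (odK g) u = g u := by
        rw [hqe _ hu]
        simp only [evK, odK]
        ring
      rw [e] at h3
      refine h3.congr' ?_
      filter_upwards [self_mem_nhdsWithin] with t ht
      exact (Talpha_pos hα hom hob hoc' ht hu).symm
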